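/- Stability (Theorem 1, deterministic sample-path form). Under all assumptions listed in the context (the fixed-sample-path versions of the paper's Assumptions 1–6), the stochastic-approximation iterates are bounded: sup_{n ≥ 0} ‖x_n‖ < ∞. -/

import Mathlib

open Filter

/-- A Lipschitz vector field vanishing at the origin has local solutions from every starting point
on a time interval of uniform length. -/
theorem exists_uniform_local_solution {E : Type*} [NormedAddCommGroup E] [NormedSpace ℝ E]
    [CompleteSpace E] {f : E → E} {K : NNReal}
    (hf : LipschitzWith K f) (hf0 : f 0 = 0) :
    ∃ η : ℝ, 0 < η ∧ ∀ x : E, ∃ γ : ℝ → E, γ 0 = x ∧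
      ∀ s ∈ Set.Icc 0 η, HasDerivWithinAt γ (f (γ s)) (Set.Icc 0 η) s := by
  have hη : 0 < 1 / (2 * (K : ℝ) + 1) := by positivity
  refine ⟨1 / (2 * (K : ℝ) + 1), hη, fun x => ?_⟩
  have hpl : IsPicardLindelof (fun _ => f) (tmin := 0) (tmax := 1 / (2 * (K : ℝ) + 1))
      ⟨0, le_rfl, hη.le⟩ x ‖x‖₊ 0 (2 * K * ‖x‖₊) K := by
    refine IsPicardLindelof.of_time_independent (fun y hy => ?_)
      hf.lipschitzOnWith ?_
    · have h1 := hf.norm_sub_le y 0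
      have h2 : ‖y‖ ≤ 2 * ‖x‖ := by
        have := norm_le_norm_sub_add y x
        rw [mem_closedBall_iff_norm, coe_nnnorm] at hy
        linarith
      rw [hf0, sub_zero, sub_zero] at h1
      push_cast
      nlinarith [K.2]
    · have h3 : 2 * K * ‖x‖ * (1 / (2 * K + 1)) ≤ ‖x‖ := by
        rw [mul_one_div, div_le_iff₀ (by positivity)]
        nlinarith [norm_nonneg x]
      push_cast
      rw [sub_zero, sub_self, sub_zero]
      rwa [max_eq_left hη.le]
  exact hpl.exists_eq_forall_mem_Icc_hasDerivWithinAt₀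

/-- Global forward existence for a Lipschitz vector field vanishing at the origin. -/
theorem exists_global_solution {E : Type*} [NormedAddCommGroup E] [NormedSpace ℝ E]
    [CompleteSpace E] {f : E → E} {K : NNReal}
    (hf : LipschitzWith K f) (hf0 : f 0 = 0) (x : E) :
    ∃ z : ℝ → E, z 0 = x ∧ ContinuousOn z (Set.Ici 0) ∧
      ∀ s : ℝ, 0 ≤ s → z s = z 0 + ∫ u in (0 : ℝ)..s, f (z u) := by
  obtain ⟨η, hη, hloc⟩ := exists_uniform_local_solution hf hf0
  choose γ hγ0 hγ using hloc
  let p : ℕ → E := fun k => (fun y => γ y η)^[k] x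
  have hp (k : ℕ) : p (k + 1) = γ (p k) η := Function.iterate_succ_apply' _ _ _
  let z : ℝ → E := fun s => γ (p ⌊s / η⌋₊) (s - ⌊s / η⌋₊ * η)
  have hz_Ico (k : ℕ) (s : ℝ) (h1 : k * η ≤ s) (h2 : s < (k + 1) * η) :
      z s = γ (p k) (s - k * η) := by
    have : ⌊s / η⌋₊ = k := by
      rw [Nat.floor_eq_iff (by positivity [(by positivity : 0 ≤ k * η).trans h1])]
      exact ⟨(le_div_iff₀ hη).2 h1, (div_lt_iff₀ hη).2 h2⟩
    simp only [z, this]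
  have hz_Icc (k : ℕ) (s : ℝ) (hs : s ∈ Set.Icc (k * η) ((k + 1) * η)) :
      z s = γ (p k) (s - k * η) := by
    rcases hs.2.lt_or_eq with h2 | h2
    · exact hz_Ico k s hs.1 h2
    · rw [hz_Ico (k + 1) s (by push_cast; exact h2.ge) (by push_cast; linarith), hp, h2]
      push_cast
      rw [sub_self, hγ0]
      ring_nf
  have hmaps (k : ℕ) : Set.MapsTo (fun s => s - k * η) (Set.Icc (k * η) ((k + 1) * η))
      (Set.Icc 0 η) := fun s hs => ⟨by linarith [hs.1], by linarith [hs.2]⟩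
  have hderiv (k : ℕ) (s : ℝ) (hs : s ∈ Set.Icc (k * η) ((k + 1) * η)) :
      HasDerivWithinAt z (f (z s)) (Set.Icc (k * η) ((k + 1) * η)) s := by
    have h1 := (hγ (p k) _ (hmaps k hs)).scomp s
      (((hasDerivAt_id s).sub_const (k * η)).hasDerivWithinAt) (hmaps k)
    rw [one_smul] at h1
    rw [hz_Icc k s hs]
    exact h1.congr_of_mem (fun u hu => hz_Icc k u hu) hs
  have hcont (k : ℕ) : ContinuousOn z (Set.Icc 0 (k * η)) := by
    induction k with
    | zero => simp
    | succ k ih =>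
      have h0 : 0 ≤ k * η := by positivity
      push_cast
      rw [← Set.Icc_union_Icc_eq_Icc h0 (by linarith : k * η ≤ (k + 1) * η)]
      exact ih.union_of_isClosed (fun s hs => (hderiv k s hs).continuousWithinAt)
        isClosed_Icc isClosed_Icc
  have hzc : ContinuousOn z (Set.Ici 0) := by
    intro s hs
    obtain ⟨k, hk⟩ := exists_nat_gt (s / η)
    rw [div_lt_iff₀ hη] at hk
    refine (hcont k s ⟨hs, hk.le⟩).mono_of_mem_nhdsWithin ?_
    filter_upwards [self_mem_nhdsWithin, mem_nhdsWithin_of_mem_nhds (Iio_mem_nhds hk)]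
      with u hu1 hu2 using ⟨hu1, le_of_lt hu2⟩
  refine ⟨z, by simp [z, hγ0, p], hzc, fun s hs => ?_⟩
  have hzs : ContinuousOn z (Set.Icc 0 s) := hzc.mono Set.Icc_subset_Ici_self
  rw [intervalIntegral.integral_eq_sub_of_hasDeriv_right (f := z)]
  · abel
  · rwa [Set.uIcc_of_le hs]
  · intro u hu
    rw [min_eq_left hs, max_eq_right hs] at hu
    have h1 : ⌊u / η⌋₊ * η ≤ u := (le_div_iff₀ hη).1 (Nat.floor_le (by have := hu.1; positivity))
    have h2 : u < (⌊u / η⌋₊ + 1) * η := (div_lt_iff₀ hη).1 (Nat.lt_floor_add_one _)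
    refine (hderiv _ u ⟨h1, h2.le⟩).mono_of_mem_nhdsWithin ?_
    filter_upwards [self_mem_nhdsWithin, mem_nhdsWithin_of_mem_nhds (Iio_mem_nhds h2)]
      with v hv1 hv2 using ⟨h1.trans (le_of_lt hv1), le_of_lt hv2⟩
  · apply ContinuousOn.intervalIntegrable
    rw [Set.uIcc_of_le hs]
    exact hf.continuous.comp_continuousOn hzs

/-- The weighted sums of `f` over windows of bounded length in the clock `t` tend to zero. -/
def WindowNegligible {F : Type*} [NormedAddCommGroup F] [NormedSpace ℝ F]
    (t α : ℕ → ℝ) (f : ℕ → F) : Prop :=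
  ∀ τ : ℝ, 0 < τ → ∀ ε : ℝ, 0 < ε → ∀ᶠ n in atTop, ∀ l, n ≤ l → t l - t n ≤ τ →
    ‖∑ i ∈ Finset.Ico n l, α i • f i‖ ≤ ε

/-- The weighted sums of `f` over windows of bounded length in the clock `t` are eventually
bounded. -/
def WindowBounded {F : Type*} [NormedAddCommGroup F] [NormedSpace ℝ F]
    (t α : ℕ → ℝ) (f : ℕ → F) : Prop :=
  ∀ τ : ℝ, 0 < τ → ∃ B : ℝ, 0 ≤ B ∧ ∀ᶠ n in atTop, ∀ l, n ≤ l → t l - t n ≤ τ →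
    ‖∑ i ∈ Finset.Ico n l, α i • f i‖ ≤ B

theorem sum_Ico_step {t α : ℕ → ℝ} (ht : ∀ n, t (n + 1) = t n + α n) {n l : ℕ} (h : n ≤ l) :
    ∑ i ∈ Finset.Ico n l, α i = t l - t n := by
  induction l, h using Nat.le_induction with
  | base => simp
  | succ k hk ih => rw [Finset.sum_Ico_succ_top hk, ih, ht]; ring

theorem clock_monotone {t α : ℕ → ℝ} (ht : ∀ n, t (n + 1) = t n + α n) (hα : ∀ n, 0 < α n) :
    Monotone t :=
  monotone_nat_of_le_succ fun n => by rw [ht]; linarith [hα n]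

section Window

variable {F : Type*} [NormedAddCommGroup F] [NormedSpace ℝ F] {t α : ℕ → ℝ}

theorem WindowNegligible.windowBounded (ht : ∀ n, t (n + 1) = t n + α n) (hα : ∀ n, 0 < α n)
    {f : ℕ → F} {c : F} (h : WindowNegligible t α fun i => f i - c) : WindowBounded t α f := by
  intro τ hτ
  refine ⟨1 + τ * ‖c‖, by positivity, ?_⟩
  filter_upwards [h τ hτ 1 one_pos] with n hn l hl htl
  have hsum : ∑ i ∈ Finset.Ico n l, α i • f i
      = ∑ i ∈ Finset.Ico n l, α i • (f i - c) + (t l - t n) • c := by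
    rw [← sum_Ico_step ht hl, Finset.sum_smul, ← Finset.sum_add_distrib]
    exact Finset.sum_congr rfl fun i _ => by rw [smul_sub, sub_add_cancel]
  rw [hsum]
  refine (norm_add_le _ _).trans (add_le_add (hn l hl htl) ?_)
  rw [norm_smul, Real.norm_of_nonneg (sub_nonneg.2 (clock_monotone ht hα hl))]
  gcongr

/-- A window negligible sequence from the two-sided averaging condition. -/
theorem windowNegligible_of_rate (ht : ∀ n, t (n + 1) = t n + α n) (hα : ∀ n, 0 < α n)
    {m : ℝ → ℕ} (hm : ∀ k, m (t k) = k) {f : ℕ → F}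
    (h : ∀ τ : ℝ, 0 < τ → ∀ ε : ℝ, 0 < ε → ∃ N : ℕ, ∀ n ≥ N,
      ∀ t₁ t₂ : ℝ, -τ ≤ t₁ → t₁ ≤ t₂ → t₂ ≤ τ →
        ‖∑ i ∈ Finset.Ico (m (t n + t₁)) (m (t n + t₂)), α i • f i‖ ≤ ε) :
    WindowNegligible t α f := by
  intro τ hτ ε hε
  obtain ⟨N, hN⟩ := h τ hτ ε hε
  filter_upwards [eventually_ge_atTop N] with n hn l hl htl
  have := hN n hn 0 (t l - t n) (by linarith) (sub_nonneg.2 (clock_monotone ht hα hl)) htl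
  rwa [add_zero, add_sub_cancel, hm, hm] at this

/-- Splitting an index window at the first index whose clock reaches a given level. -/
theorem exists_split_index (ht : Monotone t) {n l : ℕ} (hl : n ≤ l) (s : ℝ) :
    ∃ p, n ≤ p ∧ p ≤ l ∧ (∀ j, n ≤ j → j < p → t j < s) ∧ ∀ j, p ≤ j → j < l → s ≤ t j := by
  induction l, hl using Nat.le_induction with
  | base => exact ⟨n, le_rfl, le_rfl, by omega, by omega⟩
  | succ l hl ih =>
    by_cases hs : s ≤ t l
    · obtain ⟨p, hnp, hpl, hlt, hge⟩ := ih
      refine ⟨p, hnp, by omega, hlt, fun j hpj hj => ?_⟩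
      rcases (Nat.lt_succ_iff.1 hj).lt_or_eq with h | rfl
      exacts [hge j hpj h, hs]
    · exact ⟨l + 1, by omega, le_rfl, fun j _ hj => (ht (Nat.lt_succ_iff.1 hj)).trans_lt
        (not_le.1 hs), by omega⟩

/-- If the noise `G x` is negligible at every frozen point `x`, it is negligible along every
continuous path. -/
theorem eventually_norm_sum_path_le (ht : ∀ n, t (n + 1) = t n + α n) (hα : ∀ n, 0 < α n)
    {G : F → ℕ → F} {Λ : ℕ → ℝ} (hΛ : ∀ i, 0 ≤ Λ i)
    (hG : ∀ x y i, ‖G x i - G y i‖ ≤ Λ i * ‖x - y‖) (hΛb : WindowBounded t α Λ)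
    (hneg : ∀ x, WindowNegligible t α (G x)) {φ : ℝ → F} (hφ : ContinuousOn φ (Set.Ici 0))
    {τ : ℝ} (hτ : 0 < τ) {ε : ℝ} (hε : 0 < ε) :
    ∀ᶠ n in atTop, ∀ l, n ≤ l → t l - t n ≤ τ →
      ‖∑ i ∈ Finset.Ico n l, α i • G (φ (t i - t n)) i‖ ≤ ε := by
  have hmono := clock_monotone ht hα
  obtain ⟨B, hB0, hB⟩ := hΛb τ hτ
  set η : ℝ := ε / (2 * (B + 1)) with hη
  have hη0 : 0 < η := by positivity
  obtain ⟨δ, hδ, hδφ⟩ := Metric.uniformContinuousOn_iff_le.1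
    (isCompact_Icc.uniformContinuousOn_of_continuous
      (hφ.mono (Set.Icc_subset_Ici_self : Set.Icc 0 τ ⊆ Set.Ici 0))) η hη0
  have hsteps (k : ℕ) : ∀ ε' : ℝ, 0 < ε' → ∀ᶠ n in atTop, ∀ l, n ≤ l → t l - t n ≤ τ →
      (∀ j, n ≤ j → j < l → t j < t n + k * δ) →
      ‖∑ i ∈ Finset.Ico n l, α i • G (φ (t i - t n)) i‖
        ≤ ε' + η * ∑ i ∈ Finset.Ico n l, α i * Λ i := by
    induction k with
    | zero =>
      intro ε' hε'
      refine Eventually.of_forall fun n l hl htl hj => ?_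
      rcases hl.lt_or_eq with hlt | rfl
      · exact absurd (hj n le_rfl hlt) (by simp)
      · simpa using hε'.le
    | succ k ih =>
      intro ε' hε'
      filter_upwards [ih (ε' / 2) (half_pos hε'),
        eventually_forall_ge_atTop.2 (hneg (φ (k * δ)) τ hτ (ε' / 2) (half_pos hε'))]
        with n h1 h2 l hl htl hj
      obtain ⟨p, hnp, hpl, hlt, hge⟩ := exists_split_index hmono hl (t n + k * δ)
      have hfirst := h1 p hnp (by linarith [hmono hpl]) hlt
      have hfrozen := h2 p hnp l hpl (by linarith [hmono hnp])
      have hdiff : ‖∑ i ∈ Finset.Ico p l, α i • (G (φ (t i - t n)) i - G (φ (k * δ)) i)‖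
          ≤ η * ∑ i ∈ Finset.Ico p l, α i * Λ i := by
        rw [Finset.mul_sum]
        refine norm_sum_le_of_le _ fun i hi => ?_
        obtain ⟨hpi, hil⟩ := Finset.mem_Ico.1 hi
        have hlow := hge i hpi hil
        have hup := hj i (hnp.trans hpi) hil
        push_cast at hup
        have hiτ : t i - t n ≤ τ := by linarith [hmono hil.le]
        have hk0 : 0 ≤ k * δ := by positivity
        have hclose := hδφ (t i - t n) ⟨by linarith, hiτ⟩ (k * δ) ⟨hk0, by linarith⟩ (by
          rw [Real.dist_eq, abs_of_nonneg (by linarith)]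
          linarith)
        rw [dist_eq_norm] at hclose
        rw [norm_smul, Real.norm_of_nonneg (hα i).le]
        calc α i * ‖G (φ (t i - t n)) i - G (φ (k * δ)) i‖
            ≤ α i * (Λ i * η) := by
              have := (hG (φ (t i - t n)) (φ (k * δ)) i).trans
                (mul_le_mul_of_nonneg_left hclose (hΛ i))
              exact mul_le_mul_of_nonneg_left this (hα i).le
          _ = η * (α i * Λ i) := by ring
      have hsecond : ∑ i ∈ Finset.Ico p l, α i • G (φ (t i - t n)) i
          = ∑ i ∈ Finset.Ico p l, α i • (G (φ (t i - t n)) i - G (φ (k * δ)) i)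
            + ∑ i ∈ Finset.Ico p l, α i • G (φ (k * δ)) i := by
        rw [← Finset.sum_add_distrib]
        exact Finset.sum_congr rfl fun i _ => by rw [← smul_add, sub_add_cancel]
      rw [← Finset.sum_Ico_consecutive _ hnp hpl, ← Finset.sum_Ico_consecutive _ hnp hpl,
        hsecond, mul_add]
      refine (norm_add_le _ _).trans ?_
      linarith [norm_add_le
        (∑ i ∈ Finset.Ico p l, α i • (G (φ (t i - t n)) i - G (φ (k * δ)) i))
        (∑ i ∈ Finset.Ico p l, α i • G (φ (k * δ)) i)]
  obtain ⟨k, hk⟩ := exists_nat_gt (τ / δ)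
  rw [div_lt_iff₀ hδ] at hk
  filter_upwards [hsteps k (ε / 2) (half_pos hε), hB] with n h1 h2 l hl htl
  have hbound := h1 l hl htl fun j _ hjl => by linarith [hmono hjl.le]
  have hsum := (le_abs_self _).trans (h2 l hl htl)
  simp only [smul_eq_mul] at hsum
  have : η * ∑ i ∈ Finset.Ico n l, α i * Λ i ≤ η * (B + 1) :=
    mul_le_mul_of_nonneg_left (by linarith) hη0.le
  have hηB : η * (B + 1) = ε / 2 := by rw [hη]; field_simp
  linarith

end Window

/-- Discrete Grönwall inequality in summed form, on a finite window. -/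
theorem le_mul_exp_of_le_add_sum {e w : ℕ → ℝ} {A : ℝ} {n l : ℕ} (hl : n ≤ l)
    (hw : ∀ i, 0 ≤ w i)
    (he : ∀ i, n ≤ i → i ≤ l → e i ≤ A + ∑ j ∈ Finset.Ico n i, w j * e j) (hA : 0 ≤ A) :
    e l ≤ A * Real.exp (∑ j ∈ Finset.Ico n l, w j) := by
  have hS (i : ℕ) (hni : n ≤ i) (hil : i ≤ l) : A + ∑ j ∈ Finset.Ico n i, w j * e j
      ≤ A * Real.exp (∑ j ∈ Finset.Ico n i, w j) := by
    induction i, hni using Nat.le_induction with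
    | base => simp
    | succ i hni ih =>
      have hi := ih (by omega)
      rw [Finset.sum_Ico_succ_top hni, Finset.sum_Ico_succ_top hni, Real.exp_add]
      have h1 := mul_le_mul_of_nonneg_left ((he i hni (by omega)).trans hi) (hw i)
      have h2 := mul_le_mul_of_nonneg_left (Real.add_one_le_exp (w i))
        (mul_nonneg hA (Real.exp_pos (∑ j ∈ Finset.Ico n i, w j)).le)
      linarith
  exact (he l hl le_rfl).trans (hS l hl le_rfl)

/-- Uniform first-order expansion of a solution of an autonomous integral equation. -/
theorem exists_norm_increment_sub_le {E : Type*} [NormedAddCommGroup E] [NormedSpace ℝ E]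
    [CompleteSpace E] {f : E → E} (hf : Continuous f) {z : ℝ → E}
    (hz : ContinuousOn z (Set.Ici 0))
    (hzi : ∀ s : ℝ, 0 ≤ s → z s = z 0 + ∫ u in (0 : ℝ)..s, f (z u))
    (τ : ℝ) {ε : ℝ} (hε : 0 < ε) :
    ∃ δ : ℝ, 0 < δ ∧ ∀ a c : ℝ, 0 ≤ a → a ≤ c → c ≤ τ → c - a ≤ δ →
      ‖(c - a) • f (z a) - (z c - z a)‖ ≤ ε * (c - a) := by
  have hfz : ContinuousOn (fun u => f (z u)) (Set.Ici 0) := hf.comp_continuousOn hz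
  have hintegrable (p q : ℝ) (hp : 0 ≤ p) (hq : 0 ≤ q) :
      IntervalIntegrable (fun u => f (z u)) MeasureTheory.volume p q :=
    (hfz.mono fun u hu => (le_min hp hq).trans hu.1).intervalIntegrable
  obtain ⟨δ, hδ, hδf⟩ := Metric.uniformContinuousOn_iff_le.1
    (isCompact_Icc.uniformContinuousOn_of_continuous
      (hfz.mono (Set.Icc_subset_Ici_self : Set.Icc 0 τ ⊆ Set.Ici 0))) ε hε
  refine ⟨δ, hδ, fun a c ha hac hcτ hca => ?_⟩
  have hc : 0 ≤ c := ha.trans hac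
  have hinc : (c - a) • f (z a) - (z c - z a) = ∫ u in a..c, (f (z a) - f (z u)) := by
    rw [intervalIntegral.integral_sub intervalIntegrable_const (hintegrable a c ha hc),
      intervalIntegral.integral_const, hzi c hc, hzi a ha, add_sub_add_left_eq_sub,
      intervalIntegral.integral_interval_sub_left (hintegrable 0 c le_rfl hc) (hintegrable 0 a le_rfl ha)]
  rw [hinc, ← abs_of_nonneg (sub_nonneg.2 hac)]
  refine intervalIntegral.norm_integral_le_of_norm_le_const fun u hu => ?_
  rw [Set.uIoc_of_le hac] at hu
  rw [← dist_eq_norm]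
  refine hδf a ⟨ha, hac.trans hcτ⟩ u ⟨ha.trans hu.1.le, hu.2.trans hcτ⟩ ?_
  rw [dist_comm, Real.dist_eq, abs_of_nonneg (by linarith [hu.1])]
  linarith [hu.2]

/-- A nonnegative sequence is bounded if, above a threshold, it returns below its current value
after an excursion of proportional size, and if it cannot jump far from below the threshold. -/
theorem bounded_of_return {u : ℕ → ℝ} (hu : ∀ n, 0 ≤ u n) {N : ℕ} {C K M : ℝ}
    (hret : ∀ n ≥ N, C ≤ u n → ∃ i, n < i ∧ u i ≤ u n ∧ ∀ j, n ≤ j → j ≤ i → u j ≤ M * u n)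
    (hjump : ∀ n ≥ N, u n ≤ C → u (n + 1) ≤ K) : ∃ R : ℝ, ∀ n, u n ≤ R := by
  set K' := max K (u N)
  set M' := max M 1
  have hK0 : 0 ≤ K' := (hu N).trans (le_max_right _ _)
  have hKR : K' ≤ M' * K' := le_mul_of_one_le_left hK0 (le_max_right _ _)
  have hreturns (d : ℕ) : ∃ n, N + d ≤ n ∧ u n ≤ K' ∧ ∀ j, N ≤ j → j ≤ n → u j ≤ M' * K' := by
    induction d with
    | zero =>
      refine ⟨N, le_rfl, le_max_right _ _, fun j h1 h2 => ?_⟩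
      obtain rfl : j = N := by omega
      exact (le_max_right _ _).trans hKR
    | succ d ih =>
      obtain ⟨n, hn, hun, hj⟩ := ih
      rcases le_total C (u n) with hC | hC
      · obtain ⟨i, hi, hui, hexc⟩ := hret n (by omega) hC
        refine ⟨i, by omega, hui.trans hun, fun j h1 h2 => ?_⟩
        rcases le_total j n with hjn | hjn
        · exact hj j h1 hjn
        · calc u j ≤ M * u n := hexc j hjn h2
            _ ≤ M' * u n := mul_le_mul_of_nonneg_right (le_max_left _ _) (hu n)
            _ ≤ M' * K' := mul_le_mul_of_nonneg_left hun (zero_le_one.trans (le_max_right _ _))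
      · have hnext : u (n + 1) ≤ K' := (hjump n (by omega) hC).trans (le_max_left _ _)
        refine ⟨n + 1, by omega, hnext, fun j h1 h2 => ?_⟩
        rcases h2.lt_or_eq with h | rfl
        · exact hj j h1 (by omega)
        · exact hnext.trans hKR
  refine ⟨∑ j ∈ Finset.range N, u j + M' * K', fun n => ?_⟩
  rcases lt_or_ge n N with h | h
  · have := Finset.single_le_sum (fun j _ => hu j) (Finset.mem_range.2 h)
    linarith
  · obtain ⟨q, hq, -, hqj⟩ := hreturns n
    have := hqj n h (by omega)
    linarith [Finset.sum_nonneg fun j (_ : j ∈ Finset.range N) => hu j]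

section Scaled

variable {E : Type*} [NormedAddCommGroup E] [NormedSpace ℝ E] {t α : ℕ → ℝ}
  {H Hinf β : E → ℕ → E} {κ : ℝ → ℝ} {L Lb : ℕ → ℝ} {hinf : E → E}

/-- The limiting field vanishes at the origin, so the scaled field splits into the limiting field,
a perturbation vanishing at the origin, and the scaled value of the field at the origin. -/
theorem scaled_field_eq {𝓨 : Type*} {H Hinf b : E → 𝓨 → E} {κ : ℝ → ℝ}
    (hκ : Tendsto κ atTop (nhds 0))
    (hHc : ∀ c : ℝ, 1 ≤ c → ∀ x y, c⁻¹ • H (c • x) y - Hinf x y = κ c • b x y)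
    {c : ℝ} (hc : 1 ≤ c) (x : E) (y : 𝓨) :
    c⁻¹ • H (c • x) y = Hinf x y + κ c • (b x y - b 0 y) + c⁻¹ • H 0 y := by
  have hlim : Tendsto (fun c : ℝ => c⁻¹ • H 0 y - κ c • b 0 y) atTop (nhds 0) := by
    simpa using (tendsto_inv_atTop_zero.smul_const (H 0 y)).sub (hκ.smul_const (b 0 y))
  have hconst : Tendsto (fun c : ℝ => c⁻¹ • H 0 y - κ c • b 0 y) atTop (nhds (Hinf 0 y)) := by
    refine tendsto_const_nhds.congr' ?_
    filter_upwards [eventually_ge_atTop 1] with c hc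
    rw [← hHc c hc 0 y, smul_zero, sub_sub_cancel]
  have h0 := hHc c hc 0 y
  rw [tendsto_nhds_unique hconst hlim, smul_zero, sub_zero] at h0
  rw [smul_sub, ← hHc c hc x y, ← h0]
  abel

/-- The noise of the limiting field is negligible at every frozen point. -/
theorem windowNegligible_limit (ht : ∀ n, t (n + 1) = t n + α n) (hα : ∀ n, 0 < α n)
    (hκ : Tendsto κ atTop (nhds 0))
    (hdec : ∀ c : ℝ, 1 ≤ c → ∀ x i,
      c⁻¹ • H (c • x) i = Hinf x i + κ c • β x i + c⁻¹ • H 0 i)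
    (hβ : ∀ x i, ‖β x i‖ ≤ Lb i * ‖x‖) {h : E → E}
    (hH : ∀ x, WindowNegligible t α fun i => H x i - h x)
    (hLb : WindowBounded t α Lb) (x : E)
    (hlim : Tendsto (fun c : ℝ => c⁻¹ • h (c • x)) atTop (nhds (hinf x))) :
    WindowNegligible t α fun i => Hinf x i - hinf x := by
  intro τ hτ ε hε
  obtain ⟨B, hB0, hB⟩ := hLb τ hτ
  obtain ⟨B₀, hB₀0, hB₀⟩ := (hH 0).windowBounded ht hα τ hτ
  have hsmall : Tendsto (fun c : ℝ => |κ c| * (B * ‖x‖) + c⁻¹ * B₀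
      + τ * ‖c⁻¹ • h (c • x) - hinf x‖) atTop (nhds 0) := by
    have h1 := hκ.abs.mul_const (B * ‖x‖)
    have h2 := tendsto_inv_atTop_zero.mul_const B₀
    have h3 := (hlim.sub_const (hinf x)).norm.const_mul τ
    simpa using (h1.add h2).add h3
  obtain ⟨c, hcsmall, hc⟩ :=
    ((hsmall.eventually_le_const (half_pos hε)).and (eventually_ge_atTop 1)).exists
  have hc0 : 0 < c := by linarith
  filter_upwards [hB, hB₀, hH (c • x) τ hτ (ε / 2) (half_pos hε)] with n h1 h2 h3 l hl htl
  have hsplit : ∑ i ∈ Finset.Ico n l, α i • (Hinf x i - hinf x)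
      = c⁻¹ • ∑ i ∈ Finset.Ico n l, α i • (H (c • x) i - h (c • x))
        - κ c • ∑ i ∈ Finset.Ico n l, α i • β x i
        - c⁻¹ • ∑ i ∈ Finset.Ico n l, α i • H 0 i
        + (t l - t n) • (c⁻¹ • h (c • x) - hinf x) := by
    rw [← sum_Ico_step ht hl, Finset.sum_smul, Finset.smul_sum, Finset.smul_sum, Finset.smul_sum,
      ← Finset.sum_sub_distrib, ← Finset.sum_sub_distrib, ← Finset.sum_add_distrib]
    refine Finset.sum_congr rfl fun i _ => ?_
    have hi : Hinf x i = c⁻¹ • H (c • x) i - κ c • β x i - c⁻¹ • H 0 i := by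
      rw [hdec c hc x i]; abel
    rw [hi]
    module
  have hβsum : ‖∑ i ∈ Finset.Ico n l, α i • β x i‖ ≤ B * ‖x‖ := by
    calc ‖∑ i ∈ Finset.Ico n l, α i • β x i‖
        ≤ ∑ i ∈ Finset.Ico n l, α i • Lb i * ‖x‖ := by
          refine norm_sum_le_of_le _ fun i _ => ?_
          rw [norm_smul, Real.norm_of_nonneg (hα i).le, smul_eq_mul, mul_assoc]
          exact mul_le_mul_of_nonneg_left (hβ x i) (hα i).le
      _ = (∑ i ∈ Finset.Ico n l, α i • Lb i) * ‖x‖ := (Finset.sum_mul _ _ _).symm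
      _ ≤ B * ‖x‖ := mul_le_mul_of_nonneg_right ((le_abs_self _).trans (h1 l hl htl))
          (norm_nonneg x)
  have htpos : 0 ≤ t l - t n := sub_nonneg.2 (clock_monotone ht hα hl)
  have hcinv : 0 ≤ c⁻¹ := by positivity
  have b1 : ‖c⁻¹ • ∑ i ∈ Finset.Ico n l, α i • (H (c • x) i - h (c • x))‖ ≤ ε / 2 := by
    rw [norm_smul, Real.norm_of_nonneg hcinv]
    exact (mul_le_of_le_one_left (norm_nonneg _) (inv_le_one_of_one_le₀ hc)).trans (h3 l hl htl)
  have b2 : ‖κ c • ∑ i ∈ Finset.Ico n l, α i • β x i‖ ≤ |κ c| * (B * ‖x‖) := by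
    rw [norm_smul, Real.norm_eq_abs]
    exact mul_le_mul_of_nonneg_left hβsum (abs_nonneg _)
  have b3 : ‖c⁻¹ • ∑ i ∈ Finset.Ico n l, α i • H 0 i‖ ≤ c⁻¹ * B₀ := by
    rw [norm_smul, Real.norm_of_nonneg hcinv]
    exact mul_le_mul_of_nonneg_left (h2 l hl htl) hcinv
  have b4 : ‖(t l - t n) • (c⁻¹ • h (c • x) - hinf x)‖ ≤ τ * ‖c⁻¹ • h (c • x) - hinf x‖ := by
    rw [norm_smul, Real.norm_of_nonneg htpos]
    exact mul_le_mul_of_nonneg_right htl (norm_nonneg _)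
  rw [hsplit]
  refine (norm_add_le _ _).trans ?_
  refine (add_le_add_left ((norm_sub_le _ _).trans
    (add_le_add_left (norm_sub_le _ _) _)) _).trans ?_
  linarith

/-- Iterates scaled by a large constant track, over a bounded time window, the solution of the
limiting equation that starts close to the scaled initial iterate. -/
theorem exists_tracking [CompleteSpace E] (ht : ∀ n, t (n + 1) = t n + α n)
    (hα : ∀ n, 0 < α n) (hα0 : Tendsto α atTop (nhds 0)) (hκ : Tendsto κ atTop (nhds 0))
    (hdec : ∀ c : ℝ, 1 ≤ c → ∀ x i,
      c⁻¹ • H (c • x) i = Hinf x i + κ c • β x i + c⁻¹ • H 0 i)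
    (hβ : ∀ x i, ‖β x i‖ ≤ Lb i * ‖x‖) (hL0 : ∀ i, 0 ≤ L i) (hLb0 : ∀ i, 0 ≤ Lb i)
    (hHinf : ∀ x y i, ‖Hinf x i - Hinf y i‖ ≤ L i * ‖x - y‖)
    {K : NNReal} (hinfL : LipschitzWith K hinf)
    (hneg : ∀ x, WindowNegligible t α fun i => Hinf x i - hinf x)
    (hH0 : WindowBounded t α (H 0)) (hLb : WindowBounded t α Lb) (hL : WindowBounded t α L)
    {x : ℕ → E} (hx : ∀ n, x (n + 1) = x n + α n • H (x n) n)
    {z : ℝ → E} (hz : ContinuousOn z (Set.Ici 0))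
    (hzi : ∀ s : ℝ, 0 ≤ s → z s = z 0 + ∫ u in (0 : ℝ)..s, hinf (z u))
    {τ : ℝ} (hτ : 0 < τ) {ε : ℝ} (hε : 0 < ε) :
    ∃ ρ : ℝ, 0 < ρ ∧ ∃ (N : ℕ) (C : ℝ), ∀ n ≥ N, ∀ c ≥ C, ‖c⁻¹ • x n - z 0‖ ≤ ρ →
      ∀ l, n ≤ l → t l - t n ≤ τ → ‖c⁻¹ • x l - z (t l - t n)‖ ≤ ε := by
  have hmono := clock_monotone ht hα
  obtain ⟨B, hB0, hB⟩ := hL τ hτ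
  obtain ⟨Bb, hBb0, hBb⟩ := hLb τ hτ
  obtain ⟨B₀, hB₀0, hB₀⟩ := hH0 τ hτ
  obtain ⟨M, hM⟩ := isCompact_Icc.exists_bound_of_continuousOn
    (hz.mono (Set.Icc_subset_Ici_self : Set.Icc 0 τ ⊆ Set.Ici 0))
  have hM0 : 0 ≤ M := (norm_nonneg _).trans (hM 0 ⟨le_rfl, hτ.le⟩)
  set A : ℝ := ε / Real.exp (B + Bb) with hA
  have hA0 : 0 < A := by positivity
  have hpath := eventually_norm_sum_path_le ht hα (G := fun y i => Hinf y i - hinf y)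
    (Λ := fun i => L i + K) (fun i => add_nonneg (hL0 i) K.2)
    (fun y y' i => by
      have h1 := hHinf y y' i
      have h2 := hinfL.norm_sub_le y y'
      rw [sub_sub_sub_comm, add_mul]
      exact (norm_sub_le _ _).trans (add_le_add h1 h2))
    (by
      intro σ hσ
      obtain ⟨B', hB'0, hB'⟩ := hL σ hσ
      refine ⟨B' + K * σ, by positivity, ?_⟩
      filter_upwards [hB'] with n hn l hl htl
      simp only [smul_add, Finset.sum_add_distrib]
      refine (norm_add_le _ _).trans (add_le_add (hn l hl htl) ?_)
      rw [← Finset.sum_smul, sum_Ico_step ht hl, norm_smul,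
        Real.norm_of_nonneg (sub_nonneg.2 (hmono hl)), Real.norm_of_nonneg K.coe_nonneg, mul_comm]
      exact mul_le_mul_of_nonneg_left htl K.coe_nonneg)
    hneg hz hτ (ε := A / 4) (by positivity)
  obtain ⟨δ, hδ, hriem⟩ := exists_norm_increment_sub_le hinfL.continuous hz hzi τ
    (ε := A / (4 * τ)) (by positivity)
  have hsmall : Tendsto (fun c : ℝ => |κ c| * (Bb * M) + c⁻¹ * B₀) atTop (nhds 0) := by
    simpa using (hκ.abs.mul_const (Bb * M)).add (tendsto_inv_atTop_zero.mul_const B₀)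
  have hκ1 : ∀ᶠ c in atTop, |κ c| ≤ 1 := by
    have := hκ.abs
    rw [abs_zero] at this
    exact this.eventually_le_const one_pos
  obtain ⟨C, hC⟩ := eventually_atTop.1 ((hsmall.eventually_le_const
    (show (0 : ℝ) < A / 4 by positivity)).and (hκ1.and (eventually_ge_atTop 1)))
  obtain ⟨N, hN⟩ := eventually_atTop.1 (hB.and (hBb.and (hB₀.and (hpath.and
    (eventually_forall_ge_atTop.2 (hα0.eventually_le_const hδ))))))
  refine ⟨A / 4, by positivity, N, C, fun n hn c hc hstart l hl htl => ?_⟩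
  obtain ⟨hcs, hκc, hc1⟩ := hC c hc
  obtain ⟨hBn, hBbn, hB₀n, hpathn, hαn⟩ := hN n hn
  have hc0 : c ≠ 0 := by linarith
  have hcinv : 0 ≤ c⁻¹ := by positivity
  let e : ℕ → E := fun i => c⁻¹ • x i - z (t i - t n)
  let w : ℕ → ℝ := fun i => α i * (L i + |κ c| * Lb i)
  have hw (i : ℕ) : 0 ≤ w i :=
    mul_nonneg (hα i).le (add_nonneg (hL0 i) (mul_nonneg (abs_nonneg _) (hLb0 i)))
  let r : ℕ → E := fun j =>
    α j • (Hinf (c⁻¹ • x j) j - Hinf (z (t j - t n)) j) + κ c • α j • β (c⁻¹ • x j) j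
      + (α j • hinf (z (t j - t n)) - (z (t (j + 1) - t n) - z (t j - t n)))
  have hinc (j : ℕ) : e (j + 1) = e j + (r j + α j • (Hinf (z (t j - t n)) j
      - hinf (z (t j - t n))) + c⁻¹ • α j • H 0 j) := by
    have hd := hdec c hc1 (c⁻¹ • x j) j
    rw [smul_inv_smul₀ hc0] at hd
    simp only [e, r]
    rw [hx, smul_add, smul_comm c⁻¹ (α j), hd]
    module
  have hexp (i : ℕ) (hi : n ≤ i) : e i = e n + (∑ j ∈ Finset.Ico n i, r j
      + ∑ j ∈ Finset.Ico n i, α j • (Hinf (z (t j - t n)) j - hinf (z (t j - t n)))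
      + c⁻¹ • ∑ j ∈ Finset.Ico n i, α j • H 0 j) := by
    induction i, hi using Nat.le_induction with
    | base => simp
    | succ i hi ih =>
      rw [hinc i, ih, Finset.sum_Ico_succ_top hi, Finset.sum_Ico_succ_top hi,
        Finset.sum_Ico_succ_top hi, smul_add]
      abel
  have hr (j : ℕ) (hnj : n ≤ j) (hjl : j < l) :
      ‖r j‖ ≤ w j * ‖e j‖ + |κ c| * M * (α j • Lb j) + A / (4 * τ) * α j := by
    have hjl' : t (j + 1) - t n ≤ τ := by linarith [hmono (Nat.succ_le_of_lt hjl)]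
    have hj0 : 0 ≤ t j - t n := sub_nonneg.2 (hmono hnj)
    have hstep : t (j + 1) - t n - (t j - t n) = α j := by rw [ht]; ring
    have hzM : ‖z (t j - t n)‖ ≤ M := hM _ ⟨hj0, by linarith [hmono (Nat.le_succ j)]⟩
    have h1 : ‖α j • (Hinf (c⁻¹ • x j) j - Hinf (z (t j - t n)) j)‖ ≤ α j * (L j * ‖e j‖) := by
      rw [norm_smul, Real.norm_of_nonneg (hα j).le]
      exact mul_le_mul_of_nonneg_left (hHinf _ _ j) (hα j).le
    have hxj : ‖c⁻¹ • x j‖ ≤ ‖e j‖ + M := by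
      have := norm_le_norm_sub_add (c⁻¹ • x j) (z (t j - t n))
      linarith
    have h2 : ‖κ c • α j • β (c⁻¹ • x j) j‖ ≤ |κ c| * (α j * (Lb j * (‖e j‖ + M))) := by
      rw [norm_smul, norm_smul, Real.norm_of_nonneg (hα j).le, Real.norm_eq_abs]
      have := (hβ (c⁻¹ • x j) j).trans (mul_le_mul_of_nonneg_left hxj (hLb0 j))
      exact mul_le_mul_of_nonneg_left (mul_le_mul_of_nonneg_left this (hα j).le) (abs_nonneg _)
    have h3 := hriem (t j - t n) (t (j + 1) - t n) hj0 (by linarith [hα j]) hjl'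
      (hstep.le.trans (hαn j hnj))
    rw [hstep] at h3
    refine (norm_add₃_le).trans ((add_le_add (add_le_add h1 h2) h3).trans_eq ?_)
    simp only [w, smul_eq_mul]
    ring
  have hgron (i : ℕ) (hni : n ≤ i) (hil : i ≤ l) :
      ‖e i‖ ≤ A + ∑ j ∈ Finset.Ico n i, w j * ‖e j‖ := by
    have hti : t i - t n ≤ τ := by linarith [hmono hil]
    have hrsum : ‖∑ j ∈ Finset.Ico n i, r j‖
        ≤ ∑ j ∈ Finset.Ico n i, w j * ‖e j‖ + |κ c| * (Bb * M) + A / 4 := by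
      refine (norm_sum_le_of_le _ fun j hj => hr j (Finset.mem_Ico.1 hj).1
        ((Finset.mem_Ico.1 hj).2.trans_le hil)).trans ?_
      rw [Finset.sum_add_distrib, Finset.sum_add_distrib, ← Finset.mul_sum, ← Finset.mul_sum,
        sum_Ico_step ht hni]
      have h1 : |κ c| * M * ∑ j ∈ Finset.Ico n i, α j • Lb j ≤ |κ c| * M * Bb :=
        mul_le_mul_of_nonneg_left ((le_abs_self _).trans (hBbn i hni hti)) (by positivity)
      have h2 : A / (4 * τ) * (t i - t n) ≤ A / (4 * τ) * τ :=
        mul_le_mul_of_nonneg_left hti (by positivity)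
      have h3 : A / (4 * τ) * τ = A / 4 := by field_simp
      linarith
    have h0 : ‖e n‖ ≤ A / 4 := by simpa [e] using hstart
    have hH : ‖c⁻¹ • ∑ j ∈ Finset.Ico n i, α j • H 0 j‖ ≤ c⁻¹ * B₀ := by
      rw [norm_smul, Real.norm_of_nonneg hcinv]
      exact mul_le_mul_of_nonneg_left (hB₀n i hni hti) hcinv
    rw [hexp i hni]
    have h1 := norm_add_le (e n) (∑ j ∈ Finset.Ico n i, r j
      + ∑ j ∈ Finset.Ico n i, α j • (Hinf (z (t j - t n)) j - hinf (z (t j - t n)))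
      + c⁻¹ • ∑ j ∈ Finset.Ico n i, α j • H 0 j)
    have h2 := norm_add₃_le (a := ∑ j ∈ Finset.Ico n i, r j)
      (b := ∑ j ∈ Finset.Ico n i, α j • (Hinf (z (t j - t n)) j - hinf (z (t j - t n))))
      (c := c⁻¹ • ∑ j ∈ Finset.Ico n i, α j • H 0 j)
    have h3 := hpathn i hni hti
    linarith
  refine (le_mul_exp_of_le_add_sum (e := fun i => ‖e i‖) hl hw hgron hA0.le).trans ?_
  have hwsum : ∑ j ∈ Finset.Ico n l, w j ≤ B + Bb := by
    have h1 := (le_abs_self _).trans (hBn l hl htl)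
    have h2 := (le_abs_self _).trans (hBbn l hl htl)
    simp only [smul_eq_mul] at h1 h2
    have h3 : ∑ j ∈ Finset.Ico n l, w j ≤ ∑ j ∈ Finset.Ico n l, (α j * L j + α j * Lb j) :=
      Finset.sum_le_sum fun j _ => by
        rw [← mul_add]
        exact mul_le_mul_of_nonneg_left
          (add_le_add_right (mul_le_of_le_one_left (hLb0 j) hκc) _) (hα j).le
    rw [Finset.sum_add_distrib] at h3
    linarith
  calc A * Real.exp (∑ j ∈ Finset.Ico n l, w j) ≤ A * Real.exp (B + Bb) :=
        mul_le_mul_of_nonneg_left (Real.exp_le_exp.2 hwsum) hA0.le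
    _ = ε := by rw [hA]; field_simp

end Scaled

/-- The clock visits every unit-length time window beyond the index where the step sizes drop
below one. -/
theorem exists_index_in_window {t α : ℕ → ℝ} (ht : ∀ n, t (n + 1) = t n + α n)
    (htop : Tendsto t atTop atTop) {n : ℕ} (hα1 : ∀ j, n ≤ j → α j ≤ 1) {s : ℝ} (hs : 0 < s) :
    ∃ i, n < i ∧ s ≤ t i - t n ∧ t i - t n ≤ s + 1 := by
  classical
  have hex : ∃ i, n ≤ i ∧ t n + s ≤ t i :=
    ((eventually_ge_atTop n).and (htop.eventually_ge_atTop _)).exists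
  obtain ⟨hni, hti⟩ := Nat.find_spec hex
  have hmin {k : ℕ} (hk : k < Nat.find hex) := Nat.find_min hex hk
  generalize Nat.find hex = i at hni hti hmin
  have hlt : n < i := by
    rcases hni.lt_or_eq with h | rfl
    · exact h
    · linarith
  obtain ⟨k, rfl⟩ : ∃ k, i = k + 1 := ⟨i - 1, by omega⟩
  have hk : t k < t n + s := by
    by_contra hcon
    exact hmin (Nat.lt_succ_self k) ⟨by omega, not_lt.1 hcon⟩
  have h1 := hα1 k (by omega)
  have h2 := ht k
  exact ⟨k + 1, hlt, by linarith, by linarith⟩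

theorem stability_borkar_meyn_markovian
    {E : Type*} [NormedAddCommGroup E] [NormedSpace ℝ E] [FiniteDimensional ℝ E]
    [Nontrivial E]
    {𝓨 : Type*}
    (α : ℕ → ℝ)
    (hα_pos : ∀ n, 0 < α n)
    (hα_anti : ∀ n, α (n + 1) ≤ α n)
    (hα_div : Tendsto (fun n => ∑ i ∈ Finset.range n, α i) atTop atTop)
    (hα_to0 : Tendsto α atTop (nhds 0))
    (Cα : ℝ) (hCα_pos : 0 < Cα)
    (hCα : ∀ n, α n - α (n + 1) ≤ Cα * α n ^ 2)
    (t : ℕ → ℝ) (ht : ∀ n, t n = ∑ i ∈ Finset.range n, α i)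
    (m : ℝ → ℕ)
    (hm_le : ∀ s : ℝ, 0 ≤ s → t (m s) ≤ s)
    (hm_max : ∀ s : ℝ, 0 ≤ s → ∀ i : ℕ, t i ≤ s → i ≤ m s)
    (hm_neg : ∀ s : ℝ, s < 0 → m s = 0)
    (Y : ℕ → 𝓨) (H : E → 𝓨 → E)
    (x : ℕ → E)
    (hx : ∀ n, x (n + 1) = x n + α n • H (x n) (Y (n + 1)))
    (L : 𝓨 → ℝ) (hL_nonneg : ∀ y, 0 ≤ L y)
    (hH_lip : ∀ x₁ x₂ : E, ∀ y : 𝓨, ‖H x₁ y - H x₂ y‖ ≤ L y * ‖x₁ - x₂‖)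
    (Hinf : E → 𝓨 → E) (κ : ℝ → ℝ) (hκ : Tendsto κ atTop (nhds 0))
    (b : E → 𝓨 → E) (Lb : 𝓨 → ℝ) (hLb_nonneg : ∀ y, 0 ≤ Lb y)
    (hHc : ∀ c : ℝ, 1 ≤ c → ∀ x' : E, ∀ y : 𝓨,
      c⁻¹ • H (c • x') y - Hinf x' y = κ c • b x' y)
    (hb_lip : ∀ x₁ x₂ : E, ∀ y : 𝓨, ‖b x₁ y - b x₂ y‖ ≤ Lb y * ‖x₁ - x₂‖)
    (hHinf_lip : ∀ x₁ x₂ : E, ∀ y : 𝓨, ‖Hinf x₁ y - Hinf x₂ y‖ ≤ L y * ‖x₁ - x₂‖)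
    (h : E → E) (Lbar : ℝ) (hLbar : 0 ≤ Lbar)
    (Lbbar : ℝ) (hLbbar : 0 ≤ Lbbar)
    (hrateH : ∀ τ : ℝ, 0 < τ → ∀ x' : E, ∀ ε : ℝ, 0 < ε → ∃ N : ℕ, ∀ n ≥ N,
      ∀ t₁ t₂ : ℝ, -τ ≤ t₁ → t₁ ≤ t₂ → t₂ ≤ τ →
        ‖∑ i ∈ Finset.Ico (m (t n + t₁)) (m (t n + t₂)),
            α i • (H x' (Y (i + 1)) - h x')‖ ≤ ε)
    (hrateLb : ∀ τ : ℝ, 0 < τ → ∀ ε : ℝ, 0 < ε → ∃ N : ℕ, ∀ n ≥ N,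
      ∀ t₁ t₂ : ℝ, -τ ≤ t₁ → t₁ ≤ t₂ → t₂ ≤ τ →
        |∑ i ∈ Finset.Ico (m (t n + t₁)) (m (t n + t₂)),
            α i * (Lb (Y (i + 1)) - Lbbar)| ≤ ε)
    (hrateL : ∀ τ : ℝ, 0 < τ → ∀ ε : ℝ, 0 < ε → ∃ N : ℕ, ∀ n ≥ N,
      ∀ t₁ t₂ : ℝ, -τ ≤ t₁ → t₁ ≤ t₂ → t₂ ≤ τ →
        |∑ i ∈ Finset.Ico (m (t n + t₁)) (m (t n + t₂)),
            α i * (L (Y (i + 1)) - Lbar)| ≤ ε)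
    (hh_lip : ∀ x₁ x₂ : E, ‖h x₁ - h x₂‖ ≤ Lbar * ‖x₁ - x₂‖)
    (hinf : E → E)
    (hhinf_lip : ∀ x₁ x₂ : E, ‖hinf x₁ - hinf x₂‖ ≤ Lbar * ‖x₁ - x₂‖)
    (hunif : ∀ K : Set E, IsCompact K →
      TendstoUniformlyOn (fun (c : ℝ) (x' : E) => c⁻¹ • h (c • x')) hinf atTop K)
    (hinf0 : hinf 0 = 0)
    (hglobal : ∀ z : ℝ → E, ContinuousOn z (Set.Ici 0) →
      (∀ s : ℝ, 0 ≤ s → z s = z 0 + ∫ u in (0:ℝ)..s, hinf (z u)) →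
      Tendsto z atTop (nhds 0))
    (hstable : ∀ ε : ℝ, 0 < ε → ∃ δ : ℝ, 0 < δ ∧ ∀ z : ℝ → E,
      ContinuousOn z (Set.Ici 0) →
      (∀ s : ℝ, 0 ≤ s → z s = z 0 + ∫ u in (0:ℝ)..s, hinf (z u)) →
      ‖z 0‖ ≤ δ → ∀ s : ℝ, 0 ≤ s → ‖z s‖ ≤ ε)
 :
    ∃ C : ℝ, ∀ n : ℕ, ‖x n‖ ≤ C := by
  have htstep (n : ℕ) : t (n + 1) = t n + α n := by rw [ht, ht, Finset.sum_range_succ]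
  have htmono : StrictMono t := strictMono_nat_of_lt_succ fun n => by
    rw [htstep]; linarith [hα_pos n]
  have htop : Tendsto t atTop atTop := by rwa [← funext ht] at hα_div
  have hmt (k : ℕ) : m (t k) = k := by
    have h0 : 0 ≤ t k := by rw [ht]; exact Finset.sum_nonneg fun i _ => (hα_pos i).le
    exact le_antisymm (htmono.le_iff_le.1 (hm_le _ h0)) (hm_max _ h0 k le_rfl)
  have hnegH (y : E) : WindowNegligible t α fun i => H y (Y (i + 1)) - h y :=
    windowNegligible_of_rate htstep hα_pos hmt fun τ hτ => hrateH τ hτ y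
  have hbddL : WindowBounded t α fun i => L (Y (i + 1)) :=
    (windowNegligible_of_rate htstep hα_pos hmt hrateL).windowBounded htstep hα_pos
  have hbddLb : WindowBounded t α fun i => Lb (Y (i + 1)) :=
    (windowNegligible_of_rate htstep hα_pos hmt hrateLb).windowBounded htstep hα_pos
  have hbddH0 : WindowBounded t α fun i => H 0 (Y (i + 1)) :=
    (hnegH 0).windowBounded htstep hα_pos
  have hdec (c : ℝ) (hc : 1 ≤ c) (y : E) (i : ℕ) := scaled_field_eq hκ hHc hc y (Y (i + 1))
  have hβ (y : E) (i : ℕ) : ‖b y (Y (i + 1)) - b 0 (Y (i + 1))‖ ≤ Lb (Y (i + 1)) * ‖y‖ := by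
    simpa using hb_lip y 0 (Y (i + 1))
  have hneg (y : E) : WindowNegligible t α fun i => Hinf y (Y (i + 1)) - hinf y :=
    windowNegligible_limit (H := fun y i => H y (Y (i + 1))) (Hinf := fun y i => Hinf y (Y (i + 1)))
      (β := fun y i => b y (Y (i + 1)) - b 0 (Y (i + 1))) htstep hα_pos hκ hdec hβ hnegH hbddLb y
      ((hunif {y} isCompact_singleton).tendsto_at (Set.mem_singleton y))
  have hinfL : LipschitzWith (Real.toNNReal Lbar) hinf := LipschitzWith.of_dist_le_mul fun y y' => by
    simpa [dist_eq_norm, hLbar] using hhinf_lip y y'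
  have hα1 : ∀ᶠ n in atTop, ∀ j, n ≤ j → α j ≤ 1 :=
    eventually_forall_ge_atTop.2 (hα_to0.eventually_le_const one_pos)
  have hreturn : ∃ (N : ℕ) (C M : ℝ), ∀ n ≥ N, ∀ c ≥ C, 0 < c →
      c⁻¹ • x n ∈ Metric.sphere (0 : E) 1 →
      ∃ i, n < i ∧ ‖x i‖ ≤ c ∧ ∀ j, n ≤ j → j ≤ i → ‖x j‖ ≤ M * c := by
    refine (isCompact_sphere (0 : E) 1).induction_on
      (p := fun S => ∃ (N : ℕ) (C M : ℝ), ∀ n ≥ N, ∀ c ≥ C, 0 < c → c⁻¹ • x n ∈ S →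
        ∃ i, n < i ∧ ‖x i‖ ≤ c ∧ ∀ j, n ≤ j → j ≤ i → ‖x j‖ ≤ M * c) ?_ ?_ ?_ ?_
    · exact ⟨0, 0, 0, fun n _ c _ _ hmem => hmem.elim⟩
    · rintro S S' hSS' ⟨N, C, M, hS'⟩
      exact ⟨N, C, M, fun n hn c hc hc0 hmem => hS' n hn c hc hc0 (hSS' hmem)⟩
    · rintro S S' ⟨N, C, M, hS⟩ ⟨N', C', M', hS'⟩
      refine ⟨max N N', max C C', max M M', fun n hn c hc hc0 hmem => ?_⟩
      rcases hmem with hmem | hmem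
      · obtain ⟨i, hi, hxi, hexc⟩ :=
          hS n ((le_max_left _ _).trans hn) c ((le_max_left _ _).trans hc) hc0 hmem
        exact ⟨i, hi, hxi, fun j h1 h2 => (hexc j h1 h2).trans
          (mul_le_mul_of_nonneg_right (le_max_left _ _) hc0.le)⟩
      · obtain ⟨i, hi, hxi, hexc⟩ :=
          hS' n ((le_max_right _ _).trans hn) c ((le_max_right _ _).trans hc) hc0 hmem
        exact ⟨i, hi, hxi, fun j h1 h2 => (hexc j h1 h2).trans
          (mul_le_mul_of_nonneg_right (le_max_right _ _) hc0.le)⟩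
    · intro y _
      obtain ⟨z, hz0, hzc, hzi⟩ := exists_global_solution hinfL hinf0 y
      obtain ⟨s, hs⟩ := eventually_atTop.1 ((hglobal z hzc hzi).norm.eventually_le_const
        (show ‖(0 : E)‖ < 1 / 2 by simp))
      have hτ : 0 < max s 1 + 1 := by positivity
      obtain ⟨M, hM⟩ := isCompact_Icc.exists_bound_of_continuousOn
        (hzc.mono (Set.Icc_subset_Ici_self : Set.Icc 0 (max s 1 + 1) ⊆ Set.Ici 0))
      obtain ⟨ρ, hρ, N, C, htrack⟩ := exists_tracking (H := fun y i => H y (Y (i + 1)))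
        (Hinf := fun y i => Hinf y (Y (i + 1))) (β := fun y i => b y (Y (i + 1)) - b 0 (Y (i + 1)))
        htstep hα_pos hα_to0 hκ hdec hβ (fun i => hL_nonneg (Y (i + 1)))
        (fun i => hLb_nonneg (Y (i + 1))) (fun y y' i => hHinf_lip y y' (Y (i + 1))) hinfL hneg
        hbddH0 hbddLb hbddL hx hzc hzi hτ (show (0 : ℝ) < 1 / 2 by norm_num)
      obtain ⟨N', hN'⟩ := eventually_atTop.1 hα1
      refine ⟨Metric.closedBall y ρ, mem_nhdsWithin_of_mem_nhds (Metric.closedBall_mem_nhds y hρ),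
        max N N', C, M + 1 / 2, fun n hn c hc hc0 hmem => ?_⟩
      rw [mem_closedBall_iff_norm, ← hz0] at hmem
      obtain ⟨i, hni, hlow, hup⟩ := exists_index_in_window htstep htop
        (hN' n ((le_max_right _ _).trans hn)) (show 0 < max s 1 by positivity)
      have hclose (j : ℕ) (hnj : n ≤ j) (hji : j ≤ i) :
          ‖x j‖ ≤ (‖z (t j - t n)‖ + 1 / 2) * c := by
        have h1 := htrack n ((le_max_left _ _).trans hn) c hc hmem j hnj
          (by linarith [htmono.monotone hji])
        have h2 := norm_le_norm_sub_add (c⁻¹ • x j) (z (t j - t n))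
        rw [norm_smul, norm_inv, Real.norm_of_nonneg hc0.le, inv_mul_le_iff₀ hc0] at h2
        refine h2.trans ?_
        rw [mul_comm]
        exact mul_le_mul_of_nonneg_right (by linarith) hc0.le
      refine ⟨i, hni, ?_, fun j hnj hji => ?_⟩
      · have h1 := hs (t i - t n) ((le_max_left _ _).trans hlow)
        exact (hclose i hni.le le_rfl).trans (mul_le_of_le_one_left hc0.le (by linarith))
      · have h1 := hM (t j - t n) ⟨sub_nonneg.2 (htmono.monotone hnj),
          by linarith [htmono.monotone hji]⟩
        exact (hclose j hnj hji).trans (mul_le_mul_of_nonneg_right (by linarith) hc0.le)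
  obtain ⟨N, C, M, hret⟩ := hreturn
  obtain ⟨B, -, hB⟩ := hbddL 1 one_pos
  obtain ⟨B₀, -, hB₀⟩ := hbddH0 1 one_pos
  obtain ⟨N', hN'⟩ := eventually_atTop.1 (hB.and (hB₀.and hα1))
  have hC1 : 0 < max C 1 := by positivity
  refine bounded_of_return (fun n => norm_nonneg (x n)) (N := max N N') (C := max C 1)
    (K := max C 1 + B * max C 1 + B₀) (M := M) (fun n hn hCn => ?_) fun n hn hnC => ?_
  · have hpos : 0 < ‖x n‖ := hC1.trans_le hCn
    exact hret n ((le_max_left _ _).trans hn) ‖x n‖ ((le_max_left _ _).trans hCn) hpos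
      (by simp [norm_smul, hpos.ne'])
  · obtain ⟨h1, h2, h3⟩ := hN' n ((le_max_right _ _).trans hn)
    have hwin : t (n + 1) - t n ≤ 1 := by rw [htstep]; linarith [h3 n le_rfl]
    have hL1 := (le_abs_self _).trans (h1 (n + 1) n.le_succ hwin)
    have hH1 := h2 (n + 1) n.le_succ hwin
    rw [Nat.Ico_succ_singleton, Finset.sum_singleton] at hL1 hH1
    rw [smul_eq_mul] at hL1
    have hdiff : ‖α n • (H (x n) (Y (n + 1)) - H 0 (Y (n + 1)))‖ ≤ B * max C 1 := by
      rw [norm_smul, Real.norm_of_nonneg (hα_pos n).le]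
      have h4 := hH_lip (x n) 0 (Y (n + 1))
      rw [sub_zero] at h4
      have hα0 := (hα_pos n).le
      have hL0 := hL_nonneg (Y (n + 1))
      calc α n * ‖H (x n) (Y (n + 1)) - H 0 (Y (n + 1))‖
          ≤ α n * (L (Y (n + 1)) * ‖x n‖) := mul_le_mul_of_nonneg_left h4 hα0
        _ = α n * L (Y (n + 1)) * ‖x n‖ := by ring
        _ ≤ α n * L (Y (n + 1)) * max C 1 := by gcongr
        _ ≤ B * max C 1 := mul_le_mul_of_nonneg_right hL1 hC1.le
    have hsplit : x (n + 1) = x n + α n • (H (x n) (Y (n + 1)) - H 0 (Y (n + 1)))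
        + α n • H 0 (Y (n + 1)) := by
      rw [hx, smul_sub]; abel
    rw [hsplit]
    exact norm_add₃_le.trans (add_le_add (add_le_add hnC hdiff) hH1)
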